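/- Let 0 < α < 1 and let X_α have density ρ_α(u) = (sin πα/π) u^{α−1}/(u^{2α}+2u^α cos πα+1). Then for every q > 0, E[e^{−q^{1/α} X_α}] = Σ_{k≥0} (−q)^k / Γ(1+kα), the Mittag-Leffler function evaluated at −q, provided the expectation is interpreted as the Laplace transform ∫₀^∞ e^{−q^{1/α}u} ρ_α(u) du. -/

import Mathlib

open Real MeasureTheory Set

noncomputable def hh (t s : ℝ) (w : ℂ) : ℂ := Complex.exp (t * Complex.exp w - s * w)

noncomputable def ff (t a : ℝ) (w : ℂ) : ℂ :=
  Complex.exp (t * Complex.exp w) / (1 + Complex.exp (-(a * w)))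

noncomputable def mm (t s : ℝ) (x : ℝ) : ℝ := Real.exp (-(t * Real.exp x) - s * x)

noncomputable def VV (f : ℂ → ℂ) (R : ℝ) : ℝ := ∫ θ in (0:ℝ)..π, (f (R + θ * Complex.I)).re

lemma rect_VV (f : ℂ → ℂ) (hf : ∀ w : ℂ, 0 ≤ w.im → w.im ≤ π → DifferentiableAt ℂ f w)
    (hr : ∀ x : ℝ, (f x).im = 0) (L R : ℝ) :
    VV f R = VV f L + ∫ x in L..R, (f (x + π * Complex.I)).im := by
  have hc : ∀ w : ℂ, 0 ≤ w.im → w.im ≤ π → ContinuousAt f w := fun w h1 h2 =>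
    (hf w h1 h2).continuousAt
  have hH : ∀ y : ℝ, 0 ≤ y → y ≤ π → Continuous (fun x : ℝ => f (x + y * Complex.I)) := by
    intro y h0 h1
    rw [continuous_iff_continuousAt]
    intro x
    have := hc (x + y * Complex.I) (by simpa using h0) (by simpa using h1)
    exact ContinuousAt.comp (f := fun x : ℝ => (x + y * Complex.I : ℂ)) this (by fun_prop)
  have hVv : ∀ x : ℝ, ContinuousOn (fun y : ℝ => f (x + y * Complex.I)) (uIcc 0 π) := by
    intro x y hy
    rw [uIcc_of_le pi_pos.le] at hy
    have := hc (x + y * Complex.I) (by simpa using hy.1) (by simpa using hy.2)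
    exact (ContinuousAt.comp (f := fun y : ℝ => (x + y * Complex.I : ℂ)) this
      (by fun_prop)).continuousWithinAt
  have key := Complex.integral_boundary_rect_eq_zero_of_differentiableOn f (L : ℂ) (R + π * Complex.I)
    (by
      intro w hw
      rw [Complex.mem_reProdIm] at hw
      have h2 := hw.2
      simp [uIcc_of_le pi_pos.le] at h2
      exact (hf w h2.1 h2.2).differentiableWithinAt)
  have key2 := congrArg Complex.im key
  simp only [Complex.ofReal_re, Complex.ofReal_im, Complex.add_re, Complex.add_im, Complex.mul_re,
    Complex.mul_im, Complex.I_re, Complex.I_im, Complex.sub_im, smul_eq_mul, Complex.zero_im,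
    mul_zero, mul_one, zero_mul, add_zero, zero_add, sub_zero, Complex.ofReal_zero, one_mul] at key2
  have e1 : (∫ x in L..R, f x).im = 0 := by
    have := intervalIntegral.intervalIntegral_im (𝕜 := ℂ) (f := fun x : ℝ => f x) (μ := volume)
      (a := L) (b := R) (by
        have := hH 0 le_rfl pi_pos.le
        simp at this
        exact this.intervalIntegrable _ _)
    simp only [RCLike.im_to_complex] at this
    rw [← this]
    simp [hr]
  have e2 := intervalIntegral.intervalIntegral_im (𝕜 := ℂ) (f := fun x : ℝ => f (x + π * Complex.I))
    (μ := volume) (a := L) (b := R) ((hH π pi_pos.le le_rfl).intervalIntegrable _ _)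
  have e3 := fun x : ℝ => intervalIntegral.intervalIntegral_re (𝕜 := ℂ)
    (f := fun y : ℝ => f (x + y * Complex.I))
    (μ := volume) (a := 0) (b := π) ((hVv x).intervalIntegrable)
  simp only [RCLike.im_to_complex, RCLike.re_to_complex] at e2 e3
  unfold VV
  rw [e2, e3, e3]
  rw [e1] at key2
  linarith

lemma lim_VV (f : ℂ → ℂ) (hf : ∀ w : ℂ, 0 ≤ w.im → w.im ≤ π → DifferentiableAt ℂ f w)
    (hr : ∀ x : ℝ, (f x).im = 0) (c : ℝ) (hc : Filter.Tendsto (VV f) Filter.atBot (nhds c))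
    (hi : Integrable (fun x : ℝ => (f (x + π * Complex.I)).im)) :
    VV f 1 + ∫ x in Ioi (1:ℝ), (f (x + π * Complex.I)).im
      = c + ∫ x : ℝ, (f (x + π * Complex.I)).im := by
  have h1 := intervalIntegral_tendsto_integral_Iic (1:ℝ) hi.integrableOn
    (Filter.tendsto_id (α := ℝ) (x := Filter.atBot))
  have h2 := hc.add h1
  have h3 : VV f 1 = c + ∫ x in Iic (1:ℝ), (f (x + π * Complex.I)).im := by
    refine tendsto_nhds_unique (f := fun _ : ℝ => VV f 1) (l := Filter.atBot) tendsto_const_nhds ?_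
    refine h2.congr ?_
    intro L
    exact (rect_VV f hf hr L 1).symm
  rw [h3, ← intervalIntegral.integral_Iic_add_Ioi (b := (1:ℝ)) hi.integrableOn hi.integrableOn]
  ring

lemma integral_exp_sub (g : ℝ → ℝ) :
    ∫ u in Ioi (0:ℝ), g u = ∫ x : ℝ, Real.exp x * g (Real.exp x) := by
  have := integral_image_eq_integral_abs_deriv_smul (s := univ) (f := Real.exp) (f' := Real.exp)
    MeasurableSet.univ (fun x _ => (Real.hasDerivAt_exp x).hasDerivWithinAt)
    (Real.exp_injective.injOn) g
  rw [image_univ, Real.range_exp] at this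
  simpa using this

lemma integral_mm (t s : ℝ) (ht : 0 < t) (hs : s < 0) :
    ∫ x : ℝ, mm t s x = t ^ s * Real.Gamma (-s) := by
  have h := Real.integral_rpow_mul_exp_neg_mul_Ioi (a := -s) (r := t) (by linarith) ht
  rw [integral_exp_sub] at h
  rw [one_div, Real.inv_rpow ht.le, Real.rpow_neg ht.le, inv_inv] at h
  rw [← h]
  congr 1
  ext x
  rw [← Real.exp_mul, ← Real.exp_add, ← Real.exp_add, mm]
  congr 1
  ring

lemma integrable_mm (t s : ℝ) (ht : 0 < t) (hs : s < 0) : Integrable (mm t s) := by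
  apply Integrable.of_integral_ne_zero
  rw [integral_mm t s ht hs]
  have := Real.Gamma_pos_of_pos (s := -s) (by linarith)
  have := Real.rpow_pos_of_pos ht s
  positivity

lemma continuous_mm (t s : ℝ) : Continuous (mm t s) := by
  unfold mm; fun_prop

lemma integrableOn_mm (t s : ℝ) (ht : 0 < t) (hs : -1 ≤ s) : IntegrableOn (mm t s) (Ioi 1) := by
  refine Integrable.mono' (integrable_mm t (-1) ht (by norm_num)).integrableOn
    (continuous_mm t s).aestronglyMeasurable ?_
  refine (ae_restrict_iff' measurableSet_Ioi).2 (Filter.Eventually.of_forall fun x hx => ?_)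
  have hx : (1:ℝ) < x := hx
  unfold mm
  rw [Real.norm_eq_abs, abs_of_pos (Real.exp_pos _)]
  apply Real.exp_le_exp.2
  nlinarith

lemma hh_pi (t s x : ℝ) : (hh t s (x + π * Complex.I)).im = -Real.sin (π * s) * mm t s x := by
  have : (t * Complex.exp (x + π * Complex.I) - s * (x + π * Complex.I) : ℂ)
      = ((-(t * Real.exp x) - s * x : ℝ) : ℂ) + ((-(π * s) : ℝ) : ℂ) * Complex.I := by
    rw [Complex.exp_add, Complex.exp_pi_mul_I]; push_cast; ring
  unfold hh mm
  rw [this, Complex.exp_im]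
  simp only [Complex.add_re, Complex.ofReal_re, Complex.mul_re, Complex.I_re, Complex.I_im,
    Complex.ofReal_im, Complex.add_im, Complex.mul_im, mul_zero, zero_mul, mul_one, sub_zero,
    add_zero, zero_add, Real.sin_neg]
  ring

lemma hh_real (t s x : ℝ) : (hh t s x).im = 0 := by
  unfold hh
  rw [← Complex.ofReal_exp, ← Complex.ofReal_mul, ← Complex.ofReal_mul, ← Complex.ofReal_sub,
    ← Complex.ofReal_exp, Complex.ofReal_im]

lemma norm_hh_le (t s : ℝ) (ht : 0 < t) (L θ : ℝ) :
    ‖hh t s (L + θ * Complex.I)‖ ≤ Real.exp (t * Real.exp L - s * L) := by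
  unfold hh
  rw [Complex.norm_exp]
  apply Real.exp_le_exp.2
  simp [Complex.exp_re]
  have := Real.cos_le_one θ
  have := Real.exp_pos L
  nlinarith [mul_pos ht this]

lemma hh_diff (t s : ℝ) : Differentiable ℂ (hh t s) := by
  unfold hh; fun_prop

lemma VV_tendsto_zero (f : ℂ → ℂ) (b : ℝ → ℝ) (hb : Filter.Tendsto b Filter.atBot (nhds 0))
    (h : ∀ L : ℝ, L < 0 → ∀ θ : ℝ, ‖f (L + θ * Complex.I)‖ ≤ b L) :
    Filter.Tendsto (VV f) Filter.atBot (nhds 0) := by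
  have hb' : Filter.Tendsto (fun L => b L * |π - 0|) Filter.atBot (nhds 0) := by
    simpa using hb.mul_const (|π - 0|)
  refine squeeze_zero_norm' ?_ hb'
  filter_upwards [Filter.eventually_lt_atBot (0:ℝ)] with L hL
  apply intervalIntegral.norm_integral_le_of_norm_le_const
  intro θ _
  exact (Complex.abs_re_le_norm _).trans (h L hL θ)

lemma base_neg (t s : ℝ) (ht : 0 < t) (hs : s < 0) (hs1 : -1 < s) :
    VV (hh t s) 1 - Real.sin (π * s) * ∫ x in Ioi (1:ℝ), mm t s x
      = π * (t ^ s / Real.Gamma (1 + s)) := by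
  have hl : Filter.Tendsto (VV (hh t s)) Filter.atBot (nhds 0) := by
    refine VV_tendsto_zero _ (fun L => Real.exp (t - s * L)) ?_ ?_
    · apply Real.tendsto_exp_atBot.comp
      apply Filter.tendsto_atBot_add_const_left
      simp only [← neg_mul]
      exact Filter.Tendsto.const_mul_atBot (by linarith : (0:ℝ) < -s) Filter.tendsto_id
    · intro L hL θ
      refine (norm_hh_le t s ht L θ).trans (Real.exp_le_exp.2 ?_)
      have : Real.exp L ≤ 1 := Real.exp_le_one_iff.2 hL.le
      nlinarith
  have h := lim_VV (hh t s) (fun w _ _ => hh_diff t s w) (hh_real t s) 0 hl (by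
    simp only [hh_pi]
    exact (integrable_mm t s ht hs).const_mul _)
  simp only [hh_pi, integral_const_mul, integral_mm t s ht hs] at h
  have hsin : Real.sin (π * s) < 0 := by
    have := Real.sin_neg_of_neg_of_neg_pi_lt (x := π * s) (by nlinarith [pi_pos]) (by nlinarith [pi_pos])
    exact this
  have hG := Real.Gamma_mul_Gamma_one_sub (-s)
  have hp := Real.Gamma_pos_of_pos (s := 1 + s) (by linarith)
  rw [sub_neg_eq_add, mul_neg, Real.sin_neg] at hG
  have hGs : Real.Gamma (-s) = π / -Real.sin (π * s) / Real.Gamma (1 + s) := by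
    rw [← hG]; field_simp
  rw [hGs] at h
  have hne := hsin.ne
  rw [sub_eq_add_neg, ← neg_mul, h]
  field_simp
  ring

lemma base_zero (t : ℝ) (ht : 0 < t) : VV (hh t 0) 1 = π := by
  have hl : Filter.Tendsto (VV (hh t 0)) Filter.atBot (nhds π) := by
    have : Filter.Tendsto (fun L : ℝ => ∫ θ in (0:ℝ)..π, (hh t 0 (L + θ * Complex.I)).re)
      Filter.atBot (nhds (∫ θ in (0:ℝ)..π, (1:ℝ))) := by
      apply intervalIntegral.tendsto_integral_filter_of_dominated_convergence (fun _ => Real.exp t)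
      · refine Filter.Eventually.of_forall fun L => ?_
        have : Continuous (fun θ : ℝ => (hh t 0 (L + θ * Complex.I)).re) := by unfold hh; fun_prop
        exact this.aestronglyMeasurable
      · filter_upwards [Filter.eventually_lt_atBot (0:ℝ)] with L hL
        refine Filter.Eventually.of_forall fun θ _ => ?_
        refine (Complex.abs_re_le_norm _).trans ((norm_hh_le t 0 ht L θ).trans (Real.exp_le_exp.2 ?_))
        have : Real.exp L ≤ 1 := Real.exp_le_one_iff.2 hL.le
        nlinarith
      · simp
      · refine Filter.Eventually.of_forall fun θ _ => ?_
        have h0 : Filter.Tendsto (fun L : ℝ => Complex.exp (L + θ * Complex.I)) Filter.atBot (nhds 0) := by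
          rw [tendsto_zero_iff_norm_tendsto_zero]
          simp only [Complex.norm_exp]
          simpa using Real.tendsto_exp_atBot
        have hc : Continuous (fun z : ℂ => (Complex.exp (t * z)).re) := by fun_prop
        have := (hc.tendsto 0).comp h0
        simpa [hh, Function.comp_def] using this
    simp only [intervalIntegral.integral_const, sub_zero, smul_eq_mul, mul_one] at this
    exact this
  have h := lim_VV (hh t 0) (fun w _ _ => hh_diff t 0 w) (hh_real t 0) π hl (by
    simp [hh_pi])
  simpa [hh_pi] using h

lemma rec_VV (t s : ℝ) :
    t * VV (hh t (s - 1)) 1 - s * VV (hh t s) 1 = -Real.sin (π * s) * mm t s 1 := by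
  have hd : ∀ θ : ℝ, HasDerivAt (fun θ : ℝ => hh t s (((1:ℝ):ℂ) + θ * Complex.I))
      (Complex.I * (t * hh t (s-1) (((1:ℝ):ℂ) + θ * Complex.I)
        - s * hh t s (((1:ℝ):ℂ) + θ * Complex.I))) θ := by
    intro θ
    have h1 : HasDerivAt (hh t s) ((t * Complex.exp (((1:ℝ):ℂ) + θ * Complex.I) - s) *
        hh t s (((1:ℝ):ℂ) + θ * Complex.I)) (((1:ℝ):ℂ) + θ * Complex.I) := by
      unfold hh
      have := (((Complex.hasDerivAt_exp (((1:ℝ):ℂ) + θ * Complex.I)).const_mul (t:ℂ)).sub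
        ((hasDerivAt_id (((1:ℝ):ℂ) + θ * Complex.I)).const_mul (s:ℂ))).cexp
      refine this.congr_deriv ?_
      simp only [id, Pi.sub_apply, mul_one, mul_comm]
    have h2 : HasDerivAt (fun θ : ℝ => ((1:ℝ):ℂ) + θ * Complex.I) Complex.I θ := by
      have := ((hasDerivAt_id θ).ofReal_comp.mul_const Complex.I).const_add ((1:ℝ):ℂ)
      simpa using this
    have h3 := HasDerivAt.comp θ h1 h2
    refine h3.congr_deriv ?_
    have h4 : hh t (s-1) (((1:ℝ):ℂ) + θ * Complex.I) = Complex.exp (((1:ℝ):ℂ) + θ * Complex.I) *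
        hh t s (((1:ℝ):ℂ) + θ * Complex.I) := by
      unfold hh
      rw [← Complex.exp_add]; congr 1; push_cast; ring
    rw [h4]; ring
  have hd' : ∀ θ : ℝ, HasDerivAt (fun θ : ℝ => (hh t s (((1:ℝ):ℂ) + θ * Complex.I)).im)
      (t * (hh t (s-1) (((1:ℝ):ℂ) + θ * Complex.I)).re
        - s * (hh t s (((1:ℝ):ℂ) + θ * Complex.I)).re) θ := by
    intro θ
    have := Complex.imCLM.hasFDerivAt.comp_hasDerivAt θ (hd θ)
    simpa [Function.comp_def] using this
  have hcc : ∀ s, Continuous (fun θ : ℝ => (hh t s (((1:ℝ):ℂ) + θ * Complex.I)).re) := by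
    intro s; unfold hh; fun_prop
  have hI := intervalIntegral.integral_eq_sub_of_hasDerivAt (a := 0) (b := π) (fun θ _ => hd' θ)
    (Continuous.intervalIntegrable (by
      exact ((hcc _).const_mul _).sub ((hcc _).const_mul _)) _ _)
  rw [intervalIntegral.integral_sub (((hcc _).const_mul _).intervalIntegrable _ _)
    (((hcc _).const_mul _).intervalIntegrable _ _), intervalIntegral.integral_const_mul,
    intervalIntegral.integral_const_mul, hh_pi] at hI
  have h0 := hh_real t s 1
  unfold VV
  rw [hI]
  simp at h0 ⊢
  exact h0

lemma rec_mm (t s : ℝ) (ht : 0 < t) (hs : 0 ≤ s) :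
    t * (∫ x in Ioi (1:ℝ), mm t (s-1) x) + s * (∫ x in Ioi (1:ℝ), mm t s x) = mm t s 1 := by
  have hd : ∀ x : ℝ, HasDerivAt (mm t s) (-(t * mm t (s-1) x + s * mm t s x)) x := by
    intro x
    have := ((((Real.hasDerivAt_exp x).const_mul t).neg).sub ((hasDerivAt_id x).const_mul s)).exp
    refine (this.congr_deriv ?_)
    have h4 : mm t (s-1) x = Real.exp x * mm t s x := by
      unfold mm
      rw [← Real.exp_add]; congr 1; ring
    rw [h4]; simp [mm]; ring
  have h1 := (integrableOn_mm t (s-1) ht (by linarith)).const_mul t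
  have h2 := (integrableOn_mm t s ht (by linarith)).const_mul s
  have hI := integral_Ioi_of_hasDerivAt_of_tendsto (a := (1:ℝ)) (m := 0)
    (continuous_mm t s).continuousWithinAt (fun x _ => hd x) (h1.add h2).neg (by
      have h0 : Filter.Tendsto (fun x => Real.exp (-(t * Real.exp x))) Filter.atTop (nhds 0) := by
        apply Real.tendsto_exp_neg_atTop_nhds_zero.comp
        exact Real.tendsto_exp_atTop.const_mul_atTop ht
      refine squeeze_zero' (Filter.Eventually.of_forall fun x => (Real.exp_pos _).le) ?_ h0
      filter_upwards [Filter.eventually_ge_atTop 0] with x hx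
      unfold mm
      apply Real.exp_le_exp.2
      nlinarith)
  rw [integral_neg, integral_add h1 h2, integral_const_mul, integral_const_mul] at hI
  linarith

lemma hankel (t : ℝ) (ht : 0 < t) (n : ℕ) : ∀ s : ℝ, -1 < s → s ≤ n →
    VV (hh t s) 1 - Real.sin (π * s) * ∫ x in Ioi (1:ℝ), mm t s x
      = π * (t ^ s / Real.Gamma (1 + s)) := by
  induction n with
  | zero =>
    intro s h1 h2
    rcases eq_or_lt_of_le h2 with h | h
    · simp at h; subst h
      simp [base_zero t ht]
    · exact base_neg t s ht (by simpa using h) h1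
  | succ n ih =>
    intro s h1 h2
    by_cases hs : s ≤ n
    · exact ih s h1 hs
    push Not at hs
    have hs0 : 0 < s := lt_of_le_of_lt (Nat.cast_nonneg n) hs
    have h := ih (s - 1) (by linarith) (by push_cast at h2; linarith)
    have r1 := rec_VV t s
    have r2 := rec_mm t s ht hs0.le
    have e1 : Real.sin (π * (s - 1)) = - Real.sin (π * s) := by
      rw [mul_sub, mul_one, Real.sin_sub_pi]
    rw [e1, Real.rpow_sub_one ht.ne', show 1 + (s - 1) = s by ring] at h
    rw [add_comm 1 s, Real.Gamma_add_one hs0.ne']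
    have hG := Real.Gamma_pos_of_pos hs0
    apply mul_left_cancel₀ hs0.ne'
    have : s * (π * (t ^ s / (s * Real.Gamma s))) = t * (π * (t ^ s / t / Real.Gamma s)) := by
      field_simp
    rw [this, ← h]
    linear_combination (-1) * r1 - Real.sin (π * s) * r2

lemma ff_hasSum (t a : ℝ) (ha : 0 < a) (w : ℂ) (hw : 0 < w.re) :
    HasSum (fun k : ℕ => (-1) ^ k * hh t (k * a) w) (ff t a w) := by
  have hn : ‖-Complex.exp (-(a * w))‖ < 1 := by
    rw [norm_neg, Complex.norm_exp]
    simp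
    positivity
  have := (hasSum_geometric_of_norm_lt_one hn).mul_left (Complex.exp (t * Complex.exp w))
  rw [sub_neg_eq_add, ← div_eq_mul_inv] at this
  refine this.congr_fun ?_
  intro k
  rw [neg_pow (Complex.exp _), hh, sub_eq_add_neg, Complex.exp_add, ← Complex.exp_nat_mul]
  have : (-(((k * a : ℝ)):ℂ) * w) = k * (-(a * w)) := by push_cast; ring
  rw [← neg_mul, this]
  ring

lemma one_add_ne (a : ℝ) (ha : 0 < a) (ha1 : a < 1) (w : ℂ) (h0 : 0 ≤ w.im) (h1 : w.im ≤ π) :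
    1 + Complex.exp (-(a * w)) ≠ 0 := by
  intro h
  have hi := congrArg Complex.im h
  have hr := congrArg Complex.re h
  simp [Complex.exp_im, Complex.exp_re] at hi hr
  rcases h0.eq_or_lt with h2 | h2
  · rw [← h2] at hr
    simp at hr
    have := Real.exp_pos (-(a * w.re))
    linarith
  · have := Real.sin_pos_of_pos_of_lt_pi (x := a * w.im) (by positivity) (by nlinarith)
    exact this.ne' hi

lemma ff_diff (t a : ℝ) (ha : 0 < a) (ha1 : a < 1) (w : ℂ) (h0 : 0 ≤ w.im) (h1 : w.im ≤ π) :
    DifferentiableAt ℂ (ff t a) w := by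
  unfold ff
  exact DifferentiableAt.div (by fun_prop) (by fun_prop) (one_add_ne a ha ha1 w h0 h1)

lemma ff_real (t a x : ℝ) : (ff t a x).im = 0 := by
  have : ff t a x = ((Real.exp (t * Real.exp x) / (1 + Real.exp (-(a * x))) : ℝ) : ℂ) := by
    unfold ff; push_cast; rfl
  rw [this, Complex.ofReal_im]

lemma den_pos (a : ℝ) (ha : 0 < a) (ha1 : a < 1) (v : ℝ) :
    Real.sin (π * a) ^ 2 ≤ v ^ 2 + 2 * v * Real.cos (π * a) + 1 ∧ 0 < Real.sin (π * a) := by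
  constructor
  · nlinarith [Real.sin_sq_add_cos_sq (π * a), sq_nonneg (v + Real.cos (π * a))]
  · exact Real.sin_pos_of_pos_of_lt_pi (by positivity) (by nlinarith [pi_pos])

lemma ff_pi (t a : ℝ) (ha : 0 < a) (ha1 : a < 1) (x : ℝ) : (ff t a (x + π * Complex.I)).im =
    Real.sin (π * a) * mm t (-a) x /
      (Real.exp (a * x) ^ 2 + 2 * Real.exp (a * x) * Real.cos (π * a) + 1) := by
  have e1 : Complex.exp (t * Complex.exp (x + π * Complex.I)) = (Real.exp (-(t * Real.exp x)) : ℝ) := by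
    rw [Complex.exp_add, Complex.exp_pi_mul_I]; push_cast; ring_nf
  have e2 : (-(a * (x + π * Complex.I)) : ℂ) = ((-(a * x) : ℝ) : ℂ) + ((-(π * a) : ℝ) : ℂ) * Complex.I := by
    push_cast; ring
  have hd := den_pos a ha ha1 (Real.exp (a * x))
  have hd' : 0 < Real.exp (a * x) ^ 2 + 2 * Real.exp (a * x) * Real.cos (π * a) + 1 :=
    lt_of_lt_of_le (pow_pos hd.2 2) hd.1
  have e3 : mm t (-a) x = Real.exp (-(t * Real.exp x)) * Real.exp (a * x) := by
    unfold mm; rw [← Real.exp_add]; ring_nf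
  have hre : (1 + Complex.exp (-(a * (x + π * Complex.I)))).re
      = 1 + (Real.exp (a * x))⁻¹ * Real.cos (π * a) := by
    rw [e2, Complex.add_re, Complex.exp_re]
    simp only [Complex.add_re, Complex.ofReal_re, Complex.mul_re, Complex.I_re, Complex.I_im,
      Complex.ofReal_im, Complex.add_im, Complex.mul_im, mul_zero, zero_mul, mul_one, sub_zero,
      add_zero, zero_add, Real.cos_neg, Real.exp_neg, Complex.one_re]
  have him : (1 + Complex.exp (-(a * (x + π * Complex.I)))).im
      = -((Real.exp (a * x))⁻¹ * Real.sin (π * a)) := by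
    rw [e2, Complex.add_im, Complex.exp_im]
    simp only [Complex.add_re, Complex.ofReal_re, Complex.mul_re, Complex.I_re, Complex.I_im,
      Complex.ofReal_im, Complex.add_im, Complex.mul_im, mul_zero, zero_mul, mul_one, sub_zero,
      add_zero, zero_add, Real.sin_neg, Real.exp_neg, Complex.one_im, mul_neg]
  have hE := Real.exp_pos (a * x)
  have hns : Complex.normSq (1 + Complex.exp (-(a * (x + π * Complex.I))))
      = (Real.exp (a * x) ^ 2 + 2 * Real.exp (a * x) * Real.cos (π * a) + 1) / Real.exp (a * x) ^ 2 := by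
    rw [Complex.normSq_apply, hre, him]
    field_simp
    linear_combination Real.sin_sq_add_cos_sq (a * π)
  unfold ff
  rw [e1, Complex.div_im, hns, hre, him, e3, Complex.ofReal_re, Complex.ofReal_im]
  field_simp
  ring

lemma ff_int (t a : ℝ) (ht : 0 < t) (ha : 0 < a) (ha1 : a < 1) :
    Integrable (fun x : ℝ => (ff t a (x + π * Complex.I)).im) := by
  have hs := (den_pos a ha ha1 0).2
  simp only [ff_pi t a ha ha1]
  have hp : ∀ x, 0 < Real.exp (a * x) ^ 2 + 2 * Real.exp (a * x) * Real.cos (π * a) + 1 := fun x =>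
    lt_of_lt_of_le (pow_pos hs 2) (den_pos a ha ha1 (Real.exp (a * x))).1
  refine Integrable.mono' ((integrable_mm t (-a) ht (by linarith)).const_mul (1 / Real.sin (π * a))) ?_ ?_
  · refine Continuous.aestronglyMeasurable ?_
    have := continuous_mm t (-a)
    exact Continuous.div (by fun_prop) (by fun_prop) (fun x => (hp x).ne')
  · refine Filter.Eventually.of_forall fun x => ?_
    have hm : 0 < mm t (-a) x := Real.exp_pos _
    have h2 := hp x
    have h3 := (den_pos a ha ha1 (Real.exp (a * x))).1
    rw [Real.norm_of_nonneg (by positivity), div_le_iff₀ h2]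
    calc _ = (1 / Real.sin (π * a) * mm t (-a) x) * Real.sin (π * a) ^ 2 := by field_simp
      _ ≤ _ := by gcongr

lemma ff_lim (t a : ℝ) (ht : 0 < t) (ha : 0 < a) :
    Filter.Tendsto (VV (ff t a)) Filter.atBot (nhds 0) := by
  refine VV_tendsto_zero _ (fun L => Real.exp t / (Real.exp (-(a * L)) - 1)) ?_ ?_
  · apply Filter.Tendsto.const_div_atTop
    apply Filter.tendsto_atTop_add_const_right
    apply Real.tendsto_exp_atTop.comp
    simp only [← neg_mul]
    exact Filter.tendsto_id.const_mul_atBot_of_neg (by linarith)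
  · intro L hL θ
    unfold ff
    have h1 := norm_hh_le t 0 ht L θ
    simp only [hh, Complex.ofReal_zero, zero_mul, sub_zero] at h1
    have h2 : Real.exp L ≤ 1 := Real.exp_le_one_iff.2 hL.le
    have h3 : 1 < Real.exp (-(a * L)) := Real.one_lt_exp_iff.2 (by nlinarith)
    have h4 : ‖Complex.exp (-(a * (L + θ * Complex.I)))‖ = Real.exp (-(a * L)) := by
      rw [Complex.norm_exp]; simp
    have h5 := norm_sub_le (1 + Complex.exp (-(a * (L + θ * Complex.I)))) 1
    rw [add_sub_cancel_left, h4, norm_one] at h5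
    rw [norm_div]
    refine div_le_div₀ (Real.exp_pos _).le (h1.trans (Real.exp_le_exp.2 ?_)) (by linarith) (by linarith)
    nlinarith

lemma sum_VV (t a : ℝ) (ht : 0 < t) (ha : 0 < a) :
    HasSum (fun k : ℕ => (-1) ^ k * VV (hh t (k * a)) 1) (VV (ff t a) 1) := by
  unfold VV
  simp only [← intervalIntegral.integral_const_mul]
  have hg : ‖Real.exp (-a)‖ < 1 := by
    rw [Real.norm_of_nonneg (Real.exp_pos _).le]; exact Real.exp_lt_one_iff.2 (by linarith)
  apply intervalIntegral.hasSum_integral_of_dominated_convergence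
    (fun k _ => Real.exp (t * Real.exp 1) * Real.exp (-a) ^ k)
  · intro k
    have : Continuous (fun θ : ℝ => (-1 : ℝ) ^ k * (hh t (k * a) (((1:ℝ):ℂ) + θ * Complex.I)).re) := by
      unfold hh; fun_prop
    exact this.aestronglyMeasurable
  · intro k
    refine Filter.Eventually.of_forall fun θ _ => ?_
    rw [norm_mul, norm_pow, norm_neg, norm_one, one_pow, one_mul]
    refine (Complex.abs_re_le_norm _).trans ((norm_hh_le t _ ht 1 θ).trans (le_of_eq ?_))
    rw [← Real.exp_nat_mul, ← Real.exp_add]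
    ring_nf
  · refine Filter.Eventually.of_forall fun θ _ => ?_
    exact (summable_geometric_of_norm_lt_one hg).mul_left _
  · exact intervalIntegrable_const
  · refine Filter.Eventually.of_forall fun θ _ => ?_
    have := Complex.hasSum_re (ff_hasSum t a ha (((1:ℝ):ℂ) + θ * Complex.I) (by simp))
    refine this.congr_fun ?_
    intro k
    rw [show ((-1:ℂ) ^ k) = (((-1:ℝ) ^ k : ℝ) : ℂ) by push_cast; rfl, Complex.re_ofReal_mul]

lemma sum_H (t a : ℝ) (ht : 0 < t) (ha : 0 < a) :
    HasSum (fun k : ℕ => (-1) ^ k * (-Real.sin (π * (k * a)) * ∫ x in Ioi (1:ℝ), mm t (k * a) x))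
      (∫ x in Ioi (1:ℝ), (ff t a (x + π * Complex.I)).im) := by
  simp only [← integral_const_mul]
  have hg : ‖Real.exp (-a)‖ < 1 := by
    rw [Real.norm_of_nonneg (Real.exp_pos _).le]; exact Real.exp_lt_one_iff.2 (by linarith)
  apply hasSum_integral_of_dominated_convergence
    (fun k x => mm t 0 x * Real.exp (-a) ^ k)
  · intro k
    have := continuous_mm t (k * a)
    exact (by fun_prop : Continuous fun x => (-1 : ℝ) ^ k *
      (-Real.sin (π * (k * a)) * mm t (k * a) x)).aestronglyMeasurable
  · intro k
    refine (ae_restrict_iff' measurableSet_Ioi).2 (Filter.Eventually.of_forall fun x hx => ?_)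
    have hx : (1:ℝ) < x := hx
    rw [norm_mul, norm_pow, norm_neg, norm_one, one_pow, one_mul, norm_mul, norm_neg]
    have hm : 0 < mm t (k * a) x := Real.exp_pos _
    rw [Real.norm_of_nonneg hm.le]
    calc _ ≤ 1 * mm t (k * a) x := by gcongr; exact Real.abs_sin_le_one _
      _ ≤ _ := by
        rw [one_mul, ← Real.exp_nat_mul]
        unfold mm
        rw [← Real.exp_add]
        apply Real.exp_le_exp.2
        have : (0:ℝ) ≤ k * a := by positivity
        nlinarith
  · refine Filter.Eventually.of_forall fun θ => ?_
    exact (summable_geometric_of_norm_lt_one hg).mul_left _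
  · simp only [tsum_mul_left]
    exact (integrableOn_mm t 0 ht (by norm_num)).mul_const _
  · refine (ae_restrict_iff' measurableSet_Ioi).2 (Filter.Eventually.of_forall fun x hx => ?_)
    have hx : (1:ℝ) < x := hx
    have := Complex.hasSum_im (ff_hasSum t a ha ((x:ℂ) + π * Complex.I) (by simp; linarith))
    refine this.congr_fun ?_
    intro k
    rw [show ((-1:ℂ) ^ k) = (((-1:ℝ) ^ k : ℝ) : ℂ) by push_cast; rfl, Complex.im_ofReal_mul, hh_pi]

theorem stmt_19 (α : ℝ) (hα0 : 0 < α) (hα1 : α < 1) (q : ℝ) (hq : 0 < q) :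
    ∫ u in Ioi (0:ℝ),
      Real.exp (-(q ^ ((1:ℝ)/α)) * u) *
        ((Real.sin (π * α) / π) * u ^ (α - 1) /
          (u ^ (2 * α) + 2 * u ^ α * Real.cos (π * α) + 1))
    = ∑' k : ℕ, (-q) ^ k / Real.Gamma (1 + k * α) := by
  obtain ⟨t, htdef⟩ : ∃ t, t = q ^ ((1:ℝ)/α) := ⟨_, rfl⟩
  have ht : 0 < t := htdef ▸ Real.rpow_pos_of_pos hq _
  have htq : t ^ α = q := by
    rw [htdef, ← Real.rpow_mul hq.le, one_div, inv_mul_cancel₀ hα0.ne', Real.rpow_one]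
  rw [← htdef, integral_exp_sub]
  have h1 := lim_VV (ff t α) (ff_diff t α hα0 hα1) (ff_real t α) 0 (ff_lim t α ht hα0)
    (ff_int t α ht hα0 hα1)
  have h2 := (sum_VV t α ht hα0).add (sum_H t α ht hα0)
  rw [h1, zero_add] at h2
  have h3 := h2.mul_left (1 / π)
  have e : (∫ x : ℝ, Real.exp x * (Real.exp (-t * Real.exp x) *
        ((Real.sin (π * α) / π) * Real.exp x ^ (α - 1) /
          (Real.exp x ^ (2 * α) + 2 * Real.exp x ^ α * Real.cos (π * α) + 1))))
      = 1 / π * ∫ x : ℝ, (ff t α (x + π * Complex.I)).im := by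
    rw [← integral_const_mul]
    congr 1
    ext x
    rw [ff_pi t α hα0 hα1, ← Real.exp_mul, ← Real.exp_mul, ← Real.exp_mul]
    have e1 : mm t (-α) x = Real.exp x * Real.exp (-t * Real.exp x) * Real.exp (x * (α - 1)) := by
      unfold mm; rw [← Real.exp_add, ← Real.exp_add]; ring_nf
    have e2 : Real.exp (x * (2 * α)) = Real.exp (α * x) ^ 2 := by
      rw [← Real.exp_nat_mul]; push_cast; ring_nf
    rw [e1, e2, mul_comm x α]
    ring
  rw [e, ← h3.tsum_eq]
  congr 1
  ext k
  obtain ⟨n, hn⟩ := exists_nat_ge ((k:ℝ) * α)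
  have hk : (0:ℝ) ≤ k * α := by positivity
  have hh := hankel t ht n (k * α) (by linarith) hn
  have ep : t ^ ((k:ℝ) * α) = q ^ k := by
    rw [mul_comm, Real.rpow_mul ht.le, htq, Real.rpow_natCast]
  rw [ep] at hh
  have : (-q) ^ k = (-1) ^ k * q ^ k := by rw [← mul_pow]; ring
  rw [this, ← mul_add, neg_mul, ← sub_eq_add_neg, hh]
  field_simp
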